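/- Suppose W₀ is an n×m matrix with nonnegative entries, total budget c = 1ₙᵀW₀1ₘ, satisfying the regularity conditions W₀1ₘ = (c/n)·1ₙ and W₀ᵀ1ₙ = (c/m)·1ₘ, and λ₂(L(W₀)) = (1/n + 1/m)·c. Then W₀ maximizes the algebraic connectivity over the budget simplex: for every n×m matrix W with nonnegative entries and 1ₙᵀW1ₘ = c, one has λ₂(L(W)) ≤ λ₂(L(W₀)). -/

import Mathlib

open Matrix

noncomputable def supraLap {n m : ℕ} (L₁ : Matrix (Fin n) (Fin n) ℝ)
    (L₂ : Matrix (Fin m) (Fin m) ℝ) (W : Matrix (Fin n) (Fin m) ℝ) :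
    Matrix (Fin n ⊕ Fin m) (Fin n ⊕ Fin m) ℝ :=
  Matrix.fromBlocks (L₁ + Matrix.diagonal (W *ᵥ fun _ => 1)) (-W)
    (-Wᵀ) (L₂ + Matrix.diagonal (Wᵀ *ᵥ fun _ => 1))

noncomputable def lam2 {K : Type*} [Fintype K] (M : Matrix K K ℝ) : ℝ :=
  sInf {r : ℝ | ∃ v : K → ℝ, v ≠ 0 ∧ (∑ i, v i) = 0 ∧
    r = (v ⬝ᵥ (M *ᵥ v)) / (∑ i, (v i) ^ 2)}

theorem supraLap_quad {n m : ℕ} (L₁ : Matrix (Fin n) (Fin n) ℝ)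
    (L₂ : Matrix (Fin m) (Fin m) ℝ) (W : Matrix (Fin n) (Fin m) ℝ)
    (x : Fin n → ℝ) (y : Fin m → ℝ) :
    Sum.elim x y ⬝ᵥ (supraLap L₁ L₂ W *ᵥ Sum.elim x y) =
      x ⬝ᵥ (L₁ *ᵥ x) + y ⬝ᵥ (L₂ *ᵥ y) + ∑ i, ∑ j, W i j * (x i - y j) ^ 2 := by
  have e1 : x ⬝ᵥ (diagonal (W *ᵥ fun _ => 1) *ᵥ x) = ∑ i, ∑ j, W i j * x i ^ 2 := by
    rw [dotProduct]
    refine Finset.sum_congr rfl fun i _ => ?_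
    rw [mulVec_diagonal]
    simp only [mulVec, dotProduct, mul_one, transpose_apply]
    rw [Finset.sum_mul, Finset.mul_sum]
    exact Finset.sum_congr rfl fun j _ => by ring
  have e2 : y ⬝ᵥ (diagonal (Wᵀ *ᵥ fun _ => 1) *ᵥ y) = ∑ i, ∑ j, W i j * y j ^ 2 := by
    rw [Finset.sum_comm]
    rw [dotProduct]
    refine Finset.sum_congr rfl fun i _ => ?_
    rw [mulVec_diagonal]
    simp only [mulVec, dotProduct, mul_one, transpose_apply]
    rw [Finset.sum_mul, Finset.mul_sum]
    exact Finset.sum_congr rfl fun j _ => by ring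
  have e3 : x ⬝ᵥ (W *ᵥ y) = ∑ i, ∑ j, W i j * (x i * y j) := by
    simp only [dotProduct, mulVec, Finset.mul_sum]
    exact Finset.sum_congr rfl fun i _ => Finset.sum_congr rfl fun j _ => by ring
  have e4 : y ⬝ᵥ (Wᵀ *ᵥ x) = ∑ i, ∑ j, W i j * (x i * y j) := by
    rw [Finset.sum_comm]
    simp only [dotProduct, mulVec, Finset.mul_sum, transpose_apply]
    exact Finset.sum_congr rfl fun i _ => Finset.sum_congr rfl fun j _ => by ring
  have e5 : ∑ i, ∑ j, W i j * (x i - y j) ^ 2 = ∑ i, ∑ j, W i j * x i ^ 2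
      + ∑ i, ∑ j, W i j * y j ^ 2 - 2 * ∑ i, ∑ j, W i j * (x i * y j) := by
    simp only [Finset.mul_sum, ← Finset.sum_add_distrib, ← Finset.sum_sub_distrib]
    exact Finset.sum_congr rfl fun i _ => Finset.sum_congr rfl fun j _ => by ring
  rw [supraLap, fromBlocks_mulVec, sumElim_dotProduct_sumElim]
  simp only [Sum.elim_comp_inl, Sum.elim_comp_inr, add_mulVec, neg_mulVec, dotProduct_add,
    dotProduct_neg]
  rw [e1, e2, e3, e4, e5]
  ring

theorem stmt_4 {n m : ℕ} (hn : 2 ≤ n) (hm : 2 ≤ m)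
    (L₁ : Matrix (Fin n) (Fin n) ℝ) (L₂ : Matrix (Fin m) (Fin m) ℝ)
    (hL₁ : L₁.PosSemidef) (hL₂ : L₂.PosSemidef)
    (hL₁1 : L₁ *ᵥ (fun _ => 1) = 0) (hL₂1 : L₂ *ᵥ (fun _ => 1) = 0)
    (W₀ : Matrix (Fin n) (Fin m) ℝ) (hW₀ : ∀ i j, 0 ≤ W₀ i j)
    (c : ℝ) (hc : c = ∑ i, ∑ j, W₀ i j)
    (hreg1 : (W₀ *ᵥ fun _ => 1) = (fun _ => c / n))
    (hreg2 : (W₀ᵀ *ᵥ fun _ => 1) = (fun _ => c / m))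
    (hopt : lam2 (supraLap L₁ L₂ W₀) = (1 / (n : ℝ) + 1 / (m : ℝ)) * c) :
    ∀ W : Matrix (Fin n) (Fin m) ℝ, (∀ i j, 0 ≤ W i j) → (∑ i, ∑ j, W i j) = c →
      lam2 (supraLap L₁ L₂ W) ≤ lam2 (supraLap L₁ L₂ W₀) := by
  intro W hW hWc
  rw [hopt]
  have hn0 : (0 : ℝ) < n := by exact_mod_cast (by omega : 0 < n)
  have hm0 : (0 : ℝ) < m := by exact_mod_cast (by omega : 0 < m)
  apply csInf_le
  · refine ⟨0, ?_⟩
    rintro r ⟨v, -, -, rfl⟩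
    refine div_nonneg ?_ (Finset.sum_nonneg fun i _ => sq_nonneg _)
    rw [← Sum.elim_comp_inl_inr v, supraLap_quad]
    have h1 := hL₁.dotProduct_mulVec_nonneg (v ∘ Sum.inl)
    have h2 := hL₂.dotProduct_mulVec_nonneg (v ∘ Sum.inr)
    simp only [star_trivial] at h1 h2
    have h3 : 0 ≤ ∑ i, ∑ j, W i j * ((v ∘ Sum.inl) i - (v ∘ Sum.inr) j) ^ 2 :=
      Finset.sum_nonneg fun i _ => Finset.sum_nonneg fun j _ =>
        mul_nonneg (hW i j) (sq_nonneg _)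
    linarith
  · refine ⟨Sum.elim (fun _ => (m : ℝ)) (fun _ => -(n : ℝ)), ?_, ?_, ?_⟩
    · intro h
      have := congrFun h (Sum.inl ⟨0, by omega⟩)
      simp at this
      omega
    · simp [Fintype.sum_sum_type]
      ring
    · rw [supraLap_quad]
      have a1 : (fun _ : Fin n => (m : ℝ)) = (m : ℝ) • (fun _ => (1 : ℝ)) := by
        ext; simp
      have a2 : (fun _ : Fin m => -(n : ℝ)) = (-(n : ℝ)) • (fun _ => (1 : ℝ)) := by
        ext; simp
      have b1 : L₁ *ᵥ (fun _ => (m : ℝ)) = 0 := by rw [a1, mulVec_smul, hL₁1, smul_zero]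
      have b2 : L₂ *ᵥ (fun _ => -(n : ℝ)) = 0 := by rw [a2, mulVec_smul, hL₂1, smul_zero]
      rw [b1, b2]
      simp only [← Finset.sum_mul, hWc, dotProduct_zero, Fintype.sum_sum_type, Sum.elim_inl,
        Sum.elim_inr, Finset.sum_const, Finset.card_univ, Fintype.card_fin, nsmul_eq_mul]
      have : (n : ℝ) * m ^ 2 + m * (-n) ^ 2 = n * m * (n + m) := by ring
      rw [this]
      field_simp
      ring
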